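/- arXiv:2307.12314 — 6 statements merged into one kernel-verified Lean document; each statement's English description precedes it below -/
import Mathlib

section
/- Let ρ > 0, r > ρ, let A and B be complex-analytic functions on the disk {|s| < r} with B(ρ) ≠ 0, and let β ≥ 1 be a natural number. Suppose g(s) = A(s) + B(s)(1 − s/ρ)^{−β} for |s| < ρ, and let d_k denote the k-th Taylor coefficient of g at 0. Then d_k is asymptotically equivalent, as k → ∞, to (B(ρ)/Γ(β)) · k^{β−1} · ρ^{−k}, where Γ is the Euler Gamma function. -/
open Filter Asymptotics

/-- If a power series sums to a function holomorphic on a larger disk, its terms tend to zero at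
every point of that disk. -/
lemma tendsto_coeff_mul_pow_zero_of_differentiableOn {ρ r : ℝ} (hρ : 0 < ρ) {f : ℂ → ℂ}
    (hf : DifferentiableOn ℂ f (Metric.ball 0 r)) {d : ℕ → ℂ}
    (hd : ∀ s : ℂ, ‖s‖ < ρ → HasSum (fun k => d k * s ^ k) (f s)) {z : ℂ} (hz : ‖z‖ < r) :
    Tendsto (fun k => d k * z ^ k) atTop (nhds 0) := by
  have hr : 0 < r := (norm_nonneg z).trans_lt hz
  have hd' : HasFPowerSeriesAt f (FormalMultilinearSeries.ofScalars ℂ d) 0 := by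
    rw [hasFPowerSeriesAt_iff]
    filter_upwards [Metric.ball_mem_nhds (0 : ℂ) hρ] with s hs
    simpa [FormalMultilinearSeries.coeff_ofScalars, mul_comm] using hd s (by simpa using hs)
  have ht : HasFPowerSeriesAt f (FormalMultilinearSeries.ofScalars ℂ
      fun n => (n.factorial : ℂ)⁻¹ * iteratedDeriv n f 0) 0 := by
    rw [hasFPowerSeriesAt_iff]
    filter_upwards [Metric.ball_mem_nhds (0 : ℂ) hr] with s hs
    convert! Complex.hasSum_taylorSeries_on_ball hf hs using 2
    · simp [FormalMultilinearSeries.coeff_ofScalars]; ring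
    · simp
  have he : ∀ k, d k = (k.factorial : ℂ)⁻¹ * iteratedDeriv k f 0 := fun k => by
    simpa [FormalMultilinearSeries.coeff_ofScalars] using
      congr_arg (FormalMultilinearSeries.coeff · k) (hd'.eq_formalMultilinearSeries ht)
  refine (Complex.hasSum_taylorSeries_on_ball hf
    (show z ∈ Metric.ball 0 r by simpa using hz)).summable.tendsto_atTop_zero.congr fun k => ?_
  rw [he]
  simp
  ring

/-- Subtracting the leading polar part lowers the order of the pole by one. -/
lemma hasSum_sub_leading_pole {ρ : ℝ} (hρ : 0 < ρ) {A B : ℂ → ℂ} {n : ℕ} {d : ℕ → ℂ}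
    (hd : ∀ s : ℂ, ‖s‖ < ρ → HasSum (fun k => d k * s ^ k)
      (A s + B s * ((1 - s / (ρ : ℂ))⁻¹) ^ (n + 1))) {s : ℂ} (hs : ‖s‖ < ρ) :
    HasSum (fun k => (d k - B ρ * ((k + n).choose n : ℂ) * ((ρ : ℂ) ^ k)⁻¹) * s ^ k)
      (A s + -ρ * dslope B ρ s * ((1 - s / (ρ : ℂ))⁻¹) ^ n) := by
  have hρ' : (ρ : ℂ) ≠ 0 := by exact_mod_cast hρ.ne'
  have hne : s ≠ ρ := by
    rintro rfl
    simp [abs_of_pos hρ] at hs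
  have hlt : ‖s / (ρ : ℂ)‖ < 1 := by
    rw [norm_div, Complex.norm_real, Real.norm_of_nonneg hρ.le]
    exact (div_lt_one hρ).2 hs
  have h1 : (ρ : ℂ) - s ≠ 0 := sub_ne_zero.2 hne.symm
  have h1' : s - (ρ : ℂ) ≠ 0 := sub_ne_zero.2 hne
  convert! (hd s hs).sub ((hasSum_choose_mul_geometric_of_norm_lt_one n hlt).mul_left (B ρ)) using 1
  · ext k
    rw [div_pow]
    ring
  · rw [dslope_of_ne _ hne, slope_def_field, one_div, ← inv_pow, pow_succ,
      show 1 - s / (ρ : ℂ) = (ρ - s) / ρ by field_simp]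
    have : -(ρ : ℂ) * ((B s - B ρ) / (s - ρ)) = (B s - B ρ) * ((ρ - s) / ρ : ℂ)⁻¹ := by
      field_simp
      ring
    rw [this]
    ring

lemma differentiableOn_neg_mul_dslope {ρ r : ℝ} (hρ : 0 < ρ) (hr : ρ < r) {B : ℂ → ℂ}
    (hB : DifferentiableOn ℂ B (Metric.ball 0 r)) :
    DifferentiableOn ℂ (fun s => -ρ * dslope B ρ s) (Metric.ball 0 r) := by
  refine DifferentiableOn.const_mul ?_ _
  refine (Complex.differentiableOn_dslope (Metric.isOpen_ball.mem_nhds ?_)).2 hB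
  simpa [abs_of_pos hρ] using hr

lemma isEquivalent_choose_add (n : ℕ) :
    (fun k : ℕ => ((k + n).choose n : ℂ)) ~[atTop] fun k => (k : ℂ) ^ n / n.factorial := by
  have hs : (fun k : ℕ => ((k + n : ℕ) : ℝ)) ~[atTop] fun k => (k : ℝ) := by
    simp only [Nat.cast_add]
    exact IsEquivalent.refl.add_isLittleO
      (isLittleO_const_left.2 (.inr (tendsto_norm_atTop_atTop.comp tendsto_natCast_atTop_atTop)))
  have h : (fun k : ℕ => ((k + n).choose n : ℝ)) ~[atTop] fun k => (k : ℝ) ^ n / n.factorial :=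
    ((isEquivalent_choose n).comp_tendsto (tendsto_add_atTop_nat n)).trans
      ((hs.pow n).div .refl)
  refine IsLittleO.of_norm_norm (h.isLittleO.norm_norm.congr (fun k => ?_) fun k => ?_)
  · rw [← Complex.norm_real]
    simp
  · rw [← Complex.norm_real]
    simp

/-- The coefficients of a function with a pole of order at most `n` are `o(k ^ n ρ ^ (-k))`. -/
lemma isLittleO_coeff_of_pole {ρ r : ℝ} (hρ : 0 < ρ) (hr : ρ < r) {A : ℂ → ℂ}
    (hA : DifferentiableOn ℂ A (Metric.ball 0 r)) (n : ℕ) {B : ℂ → ℂ}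
    (hB : DifferentiableOn ℂ B (Metric.ball 0 r)) {d : ℕ → ℂ}
    (hd : ∀ s : ℂ, ‖s‖ < ρ → HasSum (fun k => d k * s ^ k)
      (A s + B s * ((1 - s / (ρ : ℂ))⁻¹) ^ n)) :
    (fun k => d k * (ρ : ℂ) ^ k) =o[atTop] fun k => (k : ℂ) ^ n := by
  induction n generalizing B d with
  | zero =>
    simp only [pow_zero, mul_one] at hd ⊢
    rw [isLittleO_one_iff]
    exact tendsto_coeff_mul_pow_zero_of_differentiableOn hρ (hA.add hB) hd
      (by simpa [abs_of_pos hρ] using hr)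
  | succ n ih =>
    have hρ' : (ρ : ℂ) ≠ 0 := by exact_mod_cast hρ.ne'
    have hlt : (fun k : ℕ => (k : ℂ) ^ n) =o[atTop] fun k => (k : ℂ) ^ (n + 1) :=
      (isLittleO_pow_pow_cobounded_of_lt n.lt_succ_self).comp_tendsto
        tendsto_natCast_atTop_cobounded
    have he := ih (differentiableOn_neg_mul_dslope hρ hr hB)
      fun s hs => hasSum_sub_leading_pole hρ hd hs
    have hc : (fun k : ℕ => B ρ * ((k + n).choose n : ℂ)) =O[atTop] fun k => (k : ℂ) ^ n :=
      ((isEquivalent_choose_add n).isBigO.trans (by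
        simp only [div_eq_inv_mul]
        exact isBigO_const_mul_self _ _ _)).const_mul_left _
    refine ((he.trans hlt).add (hc.trans_isLittleO hlt)).congr_left fun k => ?_
    field_simp
    ring

/-- If `g(s) = A(s) + B(s) (1 - s/ρ)^{-β}` on `|s| < ρ`, with `A, B` analytic on the
disk `|s| < r`, `r > ρ > 0`, `B(ρ) ≠ 0`, `β ≥ 1`, and `d_k` are the Taylor coefficients
of `g` at `0`, then `d_k ∼ (B(ρ)/Γ(β)) k^{β-1} ρ^{-k}` as `k → ∞`. -/
theorem taylor_coeff_asymptotics_of_pole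
    (ρ r : ℝ) (hρ : 0 < ρ) (hr : ρ < r)
    (A B : ℂ → ℂ)
    (hA : AnalyticOnNhd ℂ A (Metric.ball (0 : ℂ) r))
    (hB : AnalyticOnNhd ℂ B (Metric.ball (0 : ℂ) r))
    (hBρ : B (ρ : ℂ) ≠ 0)
    (β : ℕ) (hβ : 1 ≤ β)
    (d : ℕ → ℂ)
    (hg : ∀ s : ℂ, ‖s‖ < ρ →
      HasSum (fun k : ℕ => d k * s ^ k)
        (A s + B s * ((1 - s / (ρ : ℂ))⁻¹) ^ β)) :
    (fun k : ℕ => d k) ~[atTop]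
      (fun k : ℕ => B (ρ : ℂ) / Complex.Gamma (β : ℂ) *
        (k : ℂ) ^ (β - 1) * ((ρ : ℂ) ^ (k : ℕ))⁻¹) := by
  obtain ⟨n, rfl⟩ := Nat.exists_eq_add_of_le' hβ
  have hρ' : (ρ : ℂ) ≠ 0 := by exact_mod_cast hρ.ne'
  have hn : (n.factorial : ℂ) ≠ 0 := by exact_mod_cast n.factorial_ne_zero
  have hG : Complex.Gamma ((n + 1 : ℕ) : ℂ) = n.factorial := by
    exact_mod_cast Complex.Gamma_nat_eq_factorial n
  have hc : (fun k : ℕ => B ρ * ((k + n).choose n : ℂ)) ~[atTop]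
      fun k => B ρ / n.factorial * (k : ℂ) ^ n :=
    (IsEquivalent.refl.mul (isEquivalent_choose_add n)).congr_right
      (.of_forall fun k => by simp; ring)
  have he := isLittleO_coeff_of_pole hρ hr hA.differentiableOn n
    (differentiableOn_neg_mul_dslope hρ hr hB.differentiableOn)
    fun s hs => hasSum_sub_leading_pole hρ hg hs
  have he' := he.trans_isBigO (isBigO_self_const_mul (div_ne_zero hBρ hn) _ _)
  rw [hG, Nat.add_sub_cancel]
  refine ((hc.add_isLittleO he').mul
    (IsEquivalent.refl (u := fun k => ((ρ : ℂ) ^ k)⁻¹))).congr_left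
    (.of_forall fun k => ?_)
  simp only [Pi.mul_apply, Pi.add_apply]
  field_simp
  ring
end

section
/- Let r > 1, let A and B be complex-analytic functions on the disk {|s| < r} with B(1) ≠ 0, and let β ≥ 1 be a natural number. Suppose g(s) = A(s) + B(s)(1 − s)^{−β} for |s| < 1, and let d_k denote the k-th Taylor coefficient of g at 0. Then there exists a nonzero constant γ (namely γ = B(1)/Γ(β)) such that d_k ∼ γ·k^{β−1} as k → ∞; in particular the growth of |d_k| is polynomial of degree β − 1. -/
open Filter Asymptotics

/-- A power series on the unit disk whose sum extends holomorphically to a larger disk has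
coefficients tending to `0`. -/
theorem tendsto_zero_coeff_of_differentiableOn_ball {r : ℝ} (hr : 1 < r) {f : ℂ → ℂ}
    (hf : DifferentiableOn ℂ f (Metric.ball 0 r)) {d : ℕ → ℂ}
    (hd : ∀ s : ℂ, ‖s‖ < 1 → HasSum (fun k : ℕ => d k * s ^ k) (f s)) :
    Tendsto d atTop (nhds 0) := by
  set a : ℕ → ℂ := fun k => (k.factorial : ℂ)⁻¹ * iteratedDeriv k f 0 with ha
  have hsum : ∀ s ∈ Metric.ball (0 : ℂ) r, HasSum (fun k : ℕ => a k * s ^ k) (f s) := by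
    intro s hs
    convert! Complex.hasSum_taylorSeries_on_ball hf hs using 2 with k
    simp only [ha, smul_eq_mul, sub_zero]
    ring
  have hball : Metric.ball (0 : ℂ) 1 ∈ nhds (0 : ℂ) := Metric.ball_mem_nhds _ one_pos
  have hpow : ∀ c : ℕ → ℂ, (∀ s : ℂ, ‖s‖ < 1 → HasSum (fun k : ℕ => c k * s ^ k) (f s)) →
      HasFPowerSeriesAt f (FormalMultilinearSeries.ofScalars ℂ c) 0 := by
    intro c hc
    rw [hasFPowerSeriesAt_iff]
    filter_upwards [hball] with s hs
    simpa [FormalMultilinearSeries.coeff_ofScalars, mul_comm] using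
      hc s (by simpa using hs)
  have hda : d = a := by
    have h := (hpow d hd).eq_formalMultilinearSeries
      (hpow a fun s hs => hsum s (by simpa using hs.trans hr))
    funext k
    simpa [FormalMultilinearSeries.coeff_ofScalars] using
      congrArg (fun p : FormalMultilinearSeries ℂ ℂ ℂ => p.coeff k) h
  rw [hda]
  simpa using (hsum 1 (by simpa using hr)).summable.tendsto_atTop_zero

theorem tendsto_choose_add_div_pow (n : ℕ) :
    Tendsto (fun k : ℕ => ((k + n).choose n : ℂ) / (k : ℂ) ^ n) atTop
      (nhds ((n.factorial : ℂ)⁻¹)) := by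
  have hchoose : Tendsto (fun m : ℕ => (m.choose n : ℝ) / (m : ℝ) ^ n) atTop
      (nhds ((n.factorial : ℝ)⁻¹)) := by
    have h := (isEquivalent_choose n).div (IsEquivalent.refl (u := fun m : ℕ => (m : ℝ) ^ n))
    refine h.symm.tendsto_nhds (tendsto_const_nhds.congr' ?_)
    filter_upwards [eventually_gt_atTop 0] with m hm
    have : (m : ℝ) ≠ 0 := by positivity
    simp only [Pi.div_apply]
    field_simp
  have hratio : Tendsto (fun k : ℕ => (((k + n : ℕ) : ℝ) / (k : ℝ)) ^ n) atTop (nhds 1) := by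
    have h : Tendsto (fun k : ℕ => 1 + (n : ℝ) / (k : ℝ)) atTop (nhds (1 + 0)) :=
      tendsto_const_nhds.add (tendsto_const_div_atTop_nhds_zero_nat _)
    have h' := h.pow n
    simp only [add_zero, one_pow] at h'
    refine h'.congr' ?_
    filter_upwards [eventually_gt_atTop 0] with k hk
    have : (k : ℝ) ≠ 0 := by positivity
    push_cast
    rw [add_div, div_self this]
  have hreal := (hchoose.comp (tendsto_add_atTop_nat n)).mul hratio
  rw [mul_one] at hreal
  have h := (Complex.continuous_ofReal.tendsto _).comp hreal
  push_cast at h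
  refine h.congr' ?_
  filter_upwards [eventually_gt_atTop 0] with k hk
  have h1 : (k : ℂ) ≠ 0 := by exact_mod_cast hk.ne'
  have h2 : ((k : ℂ) + n) ≠ 0 := by exact_mod_cast (by omega : k + n ≠ 0)
  simp only [Function.comp_apply]
  push_cast
  rw [div_pow]
  field_simp

/-- Subtracting the leading polar part `B 1 / (1 - s) ^ (n + 1)` lowers the order of the pole
at `1`, leaving `A - (dslope B 1) / (1 - s) ^ n`. -/
theorem hasSum_sub_leading_polar_part {A B : ℂ → ℂ} {n : ℕ} {d : ℕ → ℂ}
    (hd : ∀ s : ℂ, ‖s‖ < 1 →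
      HasSum (fun k : ℕ => d k * s ^ k) (A s + B s * ((1 - s)⁻¹) ^ (n + 1)))
    (s : ℂ) (hs : ‖s‖ < 1) :
    HasSum (fun k : ℕ => (d k - B 1 * ((k + n).choose n : ℂ)) * s ^ k)
      (A s + (-dslope B 1 s) * ((1 - s)⁻¹) ^ n) := by
  have hne : s ≠ 1 := by
    rintro rfl
    simp at hs
  have hne' : 1 - s ≠ 0 := sub_ne_zero.2 hne.symm
  convert! (hd s hs).sub
    ((hasSum_choose_mul_geometric_of_norm_lt_one n hs).mul_left (B 1)) using 1
  · funext k
    ring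
  · have hB : B s = B 1 + (s - 1) * dslope B 1 s := by
      have := sub_smul_dslope B 1 s
      rw [smul_eq_mul] at this
      rw [this]
      ring
    rw [hB, inv_pow, inv_pow, pow_succ]
    field_simp
    ring

/-- The Taylor coefficients of a function with a pole of order at most `n` at `1` as its only
singularity in a larger disk are `o(k ^ n)`. -/
theorem tendsto_coeff_div_pow_zero {r : ℝ} (hr : 1 < r) (n : ℕ) {A B : ℂ → ℂ}
    (hA : DifferentiableOn ℂ A (Metric.ball 0 r))
    (hB : DifferentiableOn ℂ B (Metric.ball 0 r)) {d : ℕ → ℂ}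
    (hd : ∀ s : ℂ, ‖s‖ < 1 →
      HasSum (fun k : ℕ => d k * s ^ k) (A s + B s * ((1 - s)⁻¹) ^ n)) :
    Tendsto (fun k : ℕ => d k / (k : ℂ) ^ n) atTop (nhds 0) := by
  induction n generalizing B d with
  | zero =>
    simpa using tendsto_zero_coeff_of_differentiableOn_ball hr (hA.add hB)
      (by simpa using hd)
  | succ n ih =>
    have h1 : Metric.ball (0 : ℂ) r ∈ nhds (1 : ℂ) :=
      Metric.isOpen_ball.mem_nhds (by simpa using hr)
    have hC := ((Complex.differentiableOn_dslope h1).2 hB).neg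
    have hrem := ih hC (hasSum_sub_leading_polar_part hd)
    have hlim := (hrem.add ((tendsto_choose_add_div_pow n).const_mul (B 1))).mul
      (tendsto_inv_atTop_nhds_zero_nat (𝕜 := ℂ))
    rw [mul_zero] at hlim
    refine hlim.congr' ?_
    filter_upwards [eventually_gt_atTop 0] with k hk
    have : (k : ℂ) ≠ 0 := by exact_mod_cast hk.ne'
    rw [pow_succ]
    field_simp
    ring

/-- If `g(s) = A(s) + B(s) (1 - s)^{-β}` on `|s| < 1`, with `A, B` analytic on the
disk `|s| < r`, `r > 1`, `B(1) ≠ 0`, `β ≥ 1`, and `d_k` are the Taylor coefficients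
of `g` at `0`, then there is a nonzero constant `γ = B(1)/Γ(β)` with
`d_k ∼ γ k^{β-1}` as `k → ∞`: polynomial growth of degree `β - 1`. -/
theorem taylor_coeff_polynomial_growth_of_pole_at_one
    (r : ℝ) (hr : 1 < r)
    (A B : ℂ → ℂ)
    (hA : AnalyticOnNhd ℂ A (Metric.ball (0 : ℂ) r))
    (hB : AnalyticOnNhd ℂ B (Metric.ball (0 : ℂ) r))
    (hB1 : B 1 ≠ 0)
    (β : ℕ) (hβ : 1 ≤ β)
    (d : ℕ → ℂ)
    (hg : ∀ s : ℂ, ‖s‖ < 1 →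
      HasSum (fun k : ℕ => d k * s ^ k)
        (A s + B s * ((1 - s)⁻¹) ^ β)) :
    ∃ γ : ℂ, γ ≠ 0 ∧ γ = B 1 / Complex.Gamma (β : ℂ) ∧
      (fun k : ℕ => d k) ~[atTop] (fun k : ℕ => γ * (k : ℂ) ^ (β - 1)) := by
  obtain ⟨n, rfl⟩ : ∃ n, β = n + 1 := ⟨β - 1, by omega⟩
  have hfac : (n.factorial : ℂ) ≠ 0 := by exact_mod_cast n.factorial_ne_zero
  have hΓ : Complex.Gamma ((n + 1 : ℕ) : ℂ) = n.factorial := by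
    rw [Nat.cast_add_one, Complex.Gamma_nat_eq_factorial]
  have hγ : B 1 / Complex.Gamma ((n + 1 : ℕ) : ℂ) ≠ 0 := by
    rw [hΓ]
    exact div_ne_zero hB1 hfac
  refine ⟨_, hγ, rfl, ?_⟩
  rw [Nat.add_sub_cancel]
  have h1 : Metric.ball (0 : ℂ) r ∈ nhds (1 : ℂ) :=
    Metric.isOpen_ball.mem_nhds (by simpa using hr)
  have hrem := tendsto_coeff_div_pow_zero hr n hA.differentiableOn
    ((Complex.differentiableOn_dslope h1).2 hB.differentiableOn).neg
    (hasSum_sub_leading_polar_part hg)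
  have hlim := (hrem.add ((tendsto_choose_add_div_pow n).const_mul (B 1))).div_const
    (B 1 / Complex.Gamma ((n + 1 : ℕ) : ℂ))
  have hpos : ∀ᶠ k : ℕ in atTop, (k : ℂ) ≠ 0 := by
    filter_upwards [eventually_gt_atTop 0] with k hk
    exact_mod_cast hk.ne'
  rw [isEquivalent_iff_tendsto_one
    (by filter_upwards [hpos] with k hk using mul_ne_zero hγ (pow_ne_zero _ hk))]
  rw [zero_add, ← div_eq_mul_inv, ← hΓ, div_self hγ] at hlim
  refine hlim.congr' ?_
  filter_upwards [hpos] with k hk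
  simp only [Pi.div_apply]
  rw [hΓ]
  field_simp
  ring
end

section
/- Let P ∈ ℂ[s], let β_0, K ∈ ℕ and β_1, …, β_K ≥ 1 be natural numbers, and set Q(s) = (1 − s)^{β_0} · ∏_{i=1}^{K} (1 − s^{β_i}). Let (d_k)_{k∈ℕ} be the Taylor coefficients at 0 of P(s)/Q(s). Then there exists a constant C > 0 such that |d_k| ≤ C·(1 + k)^{β_0 + K − 1} for all k; consequently (1/k)·log(1 + |d_k|) → 0 as k → ∞, i.e. the growth of the sequence is polynomial and the associated algebraic entropy vanishes. -/
open Filter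

/-- The partial sums of the norms of the coefficients of `f` are `O((1+k)^n)`, and the
coefficients themselves are `O((1+k)^(n-1))`. -/
def HasPolyGrowth (n : ℕ) (f : PowerSeries ℂ) : Prop :=
  ∃ C : ℝ, 0 < C ∧ ∀ k : ℕ,
    ∑ j ∈ Finset.range (k + 1), ‖PowerSeries.coeff j f‖ ≤ C * ((1 : ℝ) + k) ^ n ∧
    ‖PowerSeries.coeff k f‖ ≤ C * ((1 : ℝ) + k) ^ (n - 1)

theorem hasPolyGrowth_polynomial (P : Polynomial ℂ) :
    HasPolyGrowth 0 (P : PowerSeries ℂ) := by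
  have key : ∀ k : ℕ, ∑ j ∈ Finset.range (k + 1), ‖PowerSeries.coeff j (P : PowerSeries ℂ)‖ ≤
      ∑ j ∈ P.support, ‖P.coeff j‖ := by
    intro k
    simp only [Polynomial.coeff_coe]
    rw [← Finset.sum_filter_ne_zero]
    refine Finset.sum_le_sum_of_subset_of_nonneg ?_ fun _ _ _ => norm_nonneg _
    intro j hj
    simpa using (Finset.mem_filter.mp hj).2
  have h0 : 0 ≤ ∑ j ∈ P.support, ‖P.coeff j‖ := Finset.sum_nonneg fun _ _ => norm_nonneg _
  refine ⟨∑ j ∈ P.support, ‖P.coeff j‖ + 1, by linarith, fun k => ?_⟩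
  have hk := key k
  have hle := Finset.single_le_sum
    (f := fun j => ‖PowerSeries.coeff j (P : PowerSeries ℂ)‖)
    (fun _ _ => norm_nonneg _) (Finset.self_mem_range_succ k)
  simp only [Nat.zero_sub, pow_zero, mul_one]
  exact ⟨by linarith, by linarith⟩

theorem norm_coeff_le_sum_of_one_sub_X_pow_mul {b : ℕ} (hb : 1 ≤ b) {f g : PowerSeries ℂ}
    (h : (1 - PowerSeries.X ^ b) * g = f) (k : ℕ) :
    ‖PowerSeries.coeff k g‖ ≤ ∑ j ∈ Finset.range (k + 1), ‖PowerSeries.coeff j f‖ := by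
  induction k using Nat.strong_induction_on with
  | _ k ih =>
    have hk : PowerSeries.coeff k g = PowerSeries.coeff k f +
        (if b ≤ k then PowerSeries.coeff (k - b) g else 0) := by
      rw [← h, sub_mul, one_mul, map_sub, PowerSeries.coeff_X_pow_mul', sub_add_cancel]
    rw [hk, Finset.sum_range_succ, add_comm]
    refine (norm_add_le _ _).trans (add_le_add ?_ le_rfl)
    split_ifs with hbk
    · refine (ih (k - b) (by omega)).trans ?_
      refine Finset.sum_le_sum_of_subset_of_nonneg ?_ fun _ _ _ => norm_nonneg _
      exact Finset.range_mono (by omega)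
    · rw [norm_zero]
      exact Finset.sum_nonneg fun _ _ => norm_nonneg _

theorem HasPolyGrowth.of_one_sub_X_pow_mul {n b : ℕ} (hb : 1 ≤ b) {f g : PowerSeries ℂ}
    (h : (1 - PowerSeries.X ^ b) * g = f) (hf : HasPolyGrowth n f) :
    HasPolyGrowth (n + 1) g := by
  obtain ⟨C, hC, hbound⟩ := hf
  have hg : ∀ k : ℕ, ‖PowerSeries.coeff k g‖ ≤ C * ((1 : ℝ) + k) ^ n := fun k =>
    (norm_coeff_le_sum_of_one_sub_X_pow_mul hb h k).trans (hbound k).1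
  refine ⟨C, hC, fun k => ⟨?_, by simpa using hg k⟩⟩
  calc ∑ j ∈ Finset.range (k + 1), ‖PowerSeries.coeff j g‖
      ≤ ∑ _j ∈ Finset.range (k + 1), C * ((1 : ℝ) + k) ^ n := by
        refine Finset.sum_le_sum fun j hj => (hg j).trans ?_
        have hjk : (j : ℝ) ≤ k := by exact_mod_cast Finset.mem_range_succ_iff.mp hj
        gcongr
    _ = C * ((1 : ℝ) + k) ^ (n + 1) := by
        rw [Finset.sum_const, Finset.card_range, nsmul_eq_mul]
        push_cast
        ring

theorem HasPolyGrowth.of_prod_mul {ι : Type*} (s : Finset ι) (β : ι → ℕ)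
    (hβ : ∀ i, 1 ≤ β i) {n : ℕ} {f g : PowerSeries ℂ}
    (h : (∏ i ∈ s, (1 - PowerSeries.X ^ β i)) * g = f) (hf : HasPolyGrowth n f) :
    HasPolyGrowth (n + s.card) g := by
  classical
  induction s using Finset.induction_on generalizing g with
  | empty => simpa [← h] using hf
  | insert a s ha ih =>
    rw [Finset.prod_insert ha, mul_comm (1 - _), mul_assoc] at h
    rw [Finset.card_insert_of_notMem ha, ← add_assoc]
    exact (ih h).of_one_sub_X_pow_mul (hβ a) rfl

theorem tendsto_log_one_add_div_of_le_pow {u : ℕ → ℝ} (hu : ∀ k, 0 ≤ u k) {C : ℝ}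
    (hC : 0 < C) {m : ℕ} (h : ∀ k : ℕ, u k ≤ C * ((1 : ℝ) + k) ^ m) :
    Tendsto (fun k : ℕ => Real.log (1 + u k) / (k : ℝ)) atTop (nhds 0) := by
  have hlog : Tendsto (fun x : ℝ => Real.log x / x) atTop (nhds 0) :=
    Real.isLittleO_log_id_atTop.tendsto_div_nhds_zero
  have hcast := tendsto_natCast_atTop_atTop (R := ℝ)
  have hinv : Tendsto (fun k : ℕ => (k : ℝ)⁻¹) atTop (nhds 0) := tendsto_inv_atTop_zero.comp hcast
  have hmain : Tendsto (fun k : ℕ => (Real.log (1 + C) + m * Real.log 2) * (k : ℝ)⁻¹ +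
      m * (Real.log (k : ℝ) / k)) atTop (nhds 0) := by
    simpa using (hinv.const_mul (Real.log (1 + C) + m * Real.log 2)).add
      ((hlog.comp hcast).const_mul (m : ℝ))
  refine squeeze_zero' (Eventually.of_forall fun k => ?_) ?_ hmain
  · exact div_nonneg (Real.log_nonneg (by linarith [hu k])) k.cast_nonneg
  · filter_upwards [eventually_ge_atTop 1] with k hk
    have hk1 : (1 : ℝ) ≤ k := by exact_mod_cast hk
    have hpow : (1 : ℝ) ≤ (2 * k) ^ m := one_le_pow₀ (by linarith)
    have hle : 1 + u k ≤ (1 + C) * (2 * k) ^ m := by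
      have : C * ((1 : ℝ) + k) ^ m ≤ C * (2 * k) ^ m := by
        gcongr
        linarith
      linarith [h k]
    have hlogle : Real.log (1 + u k) ≤
        Real.log (1 + C) + m * Real.log 2 + m * Real.log k := by
      refine (Real.log_le_log (by linarith [hu k]) hle).trans_eq ?_
      rw [Real.log_mul (by positivity) (by positivity), Real.log_pow,
        Real.log_mul (by norm_num) (by positivity)]
      ring
    calc Real.log (1 + u k) / (k : ℝ)
        ≤ (Real.log (1 + C) + m * Real.log 2 + m * Real.log k) / k := by gcongr
      _ = _ := by ring



/-- If all the poles of `g = P/Q` lie on the unit circle, with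
`Q(s) = (1-s)^{β₀} ∏_{i=1}^K (1 - s^{β_i})`, then the Taylor coefficients `d_k` of
`P/Q` grow polynomially: `|d_k| ≤ C (1+k)^{β₀+K-1}`, and hence the algebraic
entropy vanishes: `(1/k) log(1 + |d_k|) → 0`. -/
theorem polynomial_growth_of_unit_circle_poles
    (P : Polynomial ℂ) (β₀ K : ℕ) (β : Fin K → ℕ) (hβ : ∀ i, 1 ≤ β i)
    (Q : Polynomial ℂ)
    (hQ : Q = (1 - Polynomial.X) ^ β₀ *
      ∏ i : Fin K, (1 - Polynomial.X ^ β i))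
    (d : ℕ → ℂ)
    (hd : (Q : PowerSeries ℂ) * PowerSeries.mk d = (P : PowerSeries ℂ)) :
    (∃ C : ℝ, 0 < C ∧ ∀ k : ℕ, ‖d k‖ ≤ C * ((1 : ℝ) + k) ^ (β₀ + K - 1)) ∧
    Tendsto (fun k : ℕ => Real.log (1 + ‖d k‖) / (k : ℝ)) atTop (nhds 0) := by
  have hprod : (∏ i : Fin K, (1 - PowerSeries.X ^ β i)) *
      ((∏ _i ∈ Finset.range β₀, (1 - PowerSeries.X ^ 1)) * PowerSeries.mk d) =
        (P : PowerSeries ℂ) := by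
    rw [← hd, hQ, ← mul_assoc, mul_comm (∏ i : Fin K, _)]
    congr 1
    rw [Finset.prod_const, Finset.card_range, pow_one, Polynomial.coe_mul, Polynomial.coe_pow]
    congr 1
    · simp
    · rw [← Polynomial.coeToPowerSeries.ringHom_apply, map_prod]
      simp
  have hgrowth := HasPolyGrowth.of_prod_mul (Finset.range β₀) (fun _ => 1) (fun _ => le_rfl) rfl
    (HasPolyGrowth.of_prod_mul Finset.univ β hβ hprod (hasPolyGrowth_polynomial P))
  obtain ⟨C, hC, hbound⟩ := hgrowth
  have hcoeff : ∀ k : ℕ, ‖d k‖ ≤ C * ((1 : ℝ) + k) ^ (β₀ + K - 1) := fun k => by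
    simpa [add_comm] using (hbound k).2
  exact ⟨⟨C, hC, hcoeff⟩, tendsto_log_one_add_div_of_le_pow (fun _ => norm_nonneg _) hC hcoeff⟩
end

section
/- Let (d_k)_{k∈ℕ} be the sequence of Taylor coefficients at 0 of the rational function g_x(s) = (s³ + 2s + 1)/((1 − s)³(1 + s)). Then d_k/k² → 1 as k → ∞; in particular the sequence has quadratic growth and the limit lim_{k→∞} (1/k)·log d_k is zero. -/
open Filter

lemma eq_quadratic_add_oscillation {d : ℕ → ℝ}
    (h0 : d 0 = 1) (h1 : d 1 = 4) (h2 : d 2 = 8) (h3 : d 3 = 15)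
    (hrec : ∀ n, d (n + 4) = 2 * d (n + 3) - 2 * d (n + 1) + d n) (k : ℕ) :
    d k = (k : ℝ) ^ 2 + 3 / 2 * k + 5 / 4 - (-1) ^ k / 4 := by
  induction k using Nat.strong_induction_on with
  | _ k ih =>
    match k with
    | 0 => norm_num [h0]
    | 1 => norm_num [h1]
    | 2 => norm_num [h2]
    | 3 => norm_num [h3]
    | n + 4 =>
      rw [hrec, ih (n + 3) (by omega), ih (n + 1) (by omega), ih n (by omega)]
      push_cast
      ring

lemma coeff_eq_of_denominator_mul {d : ℕ → ℝ}
    (hd : (((1 - Polynomial.X) ^ 3 * (1 + Polynomial.X) : Polynomial ℝ) :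
        PowerSeries ℝ) * PowerSeries.mk d =
      ((Polynomial.X ^ 3 + 2 * Polynomial.X + 1 : Polynomial ℝ) : PowerSeries ℝ)) (k : ℕ) :
    d k = (k : ℝ) ^ 2 + 3 / 2 * k + 5 / 4 - (-1) ^ k / 4 := by
  have hden : ((1 - Polynomial.X) ^ 3 * (1 + Polynomial.X) : Polynomial ℝ) =
      1 - Polynomial.C 2 * Polynomial.X ^ 1 + Polynomial.C 2 * Polynomial.X ^ 3
        - Polynomial.X ^ 4 := by
    simp only [map_ofNat]
    ring
  have hnum : (Polynomial.X ^ 3 + 2 * Polynomial.X + 1 : Polynomial ℝ) =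
      Polynomial.X ^ 3 + Polynomial.C 2 * Polynomial.X ^ 1 + 1 := by
    simp only [map_ofNat, pow_one]
  rw [hden, hnum] at hd
  have key (n : ℕ) := congrArg (PowerSeries.coeff n) hd
  simp only [Polynomial.coe_sub, Polynomial.coe_add, Polynomial.coe_mul, Polynomial.coe_C,
    Polynomial.coe_pow, Polynomial.coe_X, Polynomial.coe_one, sub_mul, add_mul, one_mul,
    mul_assoc, map_sub, map_add, PowerSeries.coeff_C_mul, PowerSeries.coeff_X_pow_mul',
    PowerSeries.coeff_X_pow, PowerSeries.coeff_one, PowerSeries.coeff_mk] at key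
  have h0 : d 0 = 1 := by simpa using key 0
  have h1 : d 1 = 4 := by have := key 1; norm_num [h0] at this; linarith
  have h2 : d 2 = 8 := by have := key 2; norm_num [h1] at this; linarith
  have h3 : d 3 = 15 := by have := key 3; norm_num [h0, h2] at this; linarith
  refine eq_quadratic_add_oscillation h0 h1 h2 h3 (fun n => ?_) k
  have := key (n + 4)
  simp at this
  linarith

lemma tendsto_log_div_of_tendsto_div_sq {d : ℕ → ℝ}
    (h : Tendsto (fun k : ℕ => d k / (k : ℝ) ^ 2) atTop (nhds 1)) :
    Tendsto (fun k : ℕ => Real.log (d k) / (k : ℝ)) atTop (nhds 0) := by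
  have hlog : Tendsto (fun k : ℕ => Real.log (k : ℝ) / k) atTop (nhds 0) :=
    Real.isLittleO_log_id_atTop.tendsto_div_nhds_zero.comp tendsto_natCast_atTop_atTop
  have hquot : Tendsto (fun k : ℕ => Real.log (d k / (k : ℝ) ^ 2) / (k : ℝ)) atTop (nhds 0) :=
    (h.log one_ne_zero).div_atTop tendsto_natCast_atTop_atTop
  have hsum := hquot.add (hlog.const_mul 2)
  rw [mul_zero, add_zero] at hsum
  refine hsum.congr' ?_
  filter_upwards [h.eventually_ne one_ne_zero] with k hk
  obtain ⟨hdk, hk2⟩ := div_ne_zero_iff.mp hk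
  rw [Real.log_div hdk hk2, Real.log_pow]
  push_cast
  ring

/-- The Taylor coefficients `d_k` of `g_x(s) = (s³ + 2s + 1)/((1-s)³(1+s))` (degree
sequence of the field `x` of the lmKdV₂ system) satisfy `d_k/k² → 1`: quadratic
growth, hence vanishing algebraic entropy `lim (1/k) log d_k = 0`. -/
theorem lmKdV2_x_quadratic_growth
    (d : ℕ → ℝ)
    (hd : (((1 - Polynomial.X) ^ 3 * (1 + Polynomial.X) : Polynomial ℝ) :
        PowerSeries ℝ) * PowerSeries.mk d =
      ((Polynomial.X ^ 3 + 2 * Polynomial.X + 1 : Polynomial ℝ) : PowerSeries ℝ)) :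
    Tendsto (fun k : ℕ => d k / (k : ℝ) ^ 2) atTop (nhds 1) ∧
    Tendsto (fun k : ℕ => Real.log (d k) / (k : ℝ)) atTop (nhds 0) := by
  have hlim : Tendsto (fun k : ℕ => d k / (k : ℝ) ^ 2) atTop (nhds 1) := by
    have hinv : Tendsto (fun k : ℕ => (k : ℝ)⁻¹) atTop (nhds 0) :=
      tendsto_inv_atTop_nhds_zero_nat
    have hosc : Tendsto (fun k : ℕ => (-1 : ℝ) ^ k * (k : ℝ)⁻¹) atTop (nhds 0) := by
      refine squeeze_zero_norm (fun k => ?_) hinv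
      simp
    have hsum := (((hinv.const_mul (3 / 2)).const_add 1).add
      ((hinv.mul hinv).const_mul (5 / 4))).sub ((hosc.mul hinv).const_mul (1 / 4))
    norm_num only at hsum
    refine hsum.congr' ?_
    filter_upwards [eventually_ne_atTop 0] with k hk
    have hk' : (k : ℝ) ≠ 0 := Nat.cast_ne_zero.mpr hk
    rw [coeff_eq_of_denominator_mul hd k]
    field_simp
  exact ⟨hlim, tendsto_log_div_of_tendsto_div_sq hlim⟩
end

section
/- For every natural number k ≥ 2, the k-th Taylor coefficient at 0 of (s² − s + 1)/(1 − s)³ is strictly smaller than the k-th Taylor coefficient at 0 of (s³ + 2s² + 1)/((1 − s)³(1 + s)), which in turn is strictly smaller than the k-th Taylor coefficient at 0 of (s³ + 2s + 1)/((1 − s)³(1 + s)). That is, for all k ≥ 2, d_k(lmKdV) < d_{y,k}(lmKdV₂) < d_{x,k}(lmKdV₂). -/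
/-- A product of power series with nonnegative coefficients has positive coefficients as soon as
all coefficients of one factor and the constant term of the other are positive. -/
theorem coeff_mul_pos_of_pos {f g : PowerSeries ℝ} (hf : ∀ n, 0 < PowerSeries.coeff n f)
    (hg : ∀ n, 0 ≤ PowerSeries.coeff n g) (hg₀ : 0 < PowerSeries.coeff 0 g) (n : ℕ) :
    0 < PowerSeries.coeff n (f * g) := by
  rw [PowerSeries.coeff_mul]
  exact Finset.sum_pos' (fun p _ => mul_nonneg (hf p.1).le (hg p.2))
    ⟨(n, 0), by simp, mul_pos (hf n) hg₀⟩

theorem one_sub_X_sq_mul_mk_even :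
    (1 - PowerSeries.X ^ 2) * PowerSeries.mk (fun n => if Even n then (1 : ℝ) else 0) = 1 := by
  ext n
  rw [sub_mul, one_mul, map_sub, PowerSeries.coeff_X_pow_mul', PowerSeries.coeff_one]
  rcases n with _ | _ | n <;> simp [Nat.even_add]


/-- For every `k ≥ 2` the `k`-th Taylor coefficient of `(s² - s + 1)/(1-s)³`
(degree sequence of the scalar lmKdV equation) is strictly smaller than that of
`(s³ + 2s² + 1)/((1-s)³(1+s))` (field `y` of the lmKdV₂ system), which in turn is
strictly smaller than that of `(s³ + 2s + 1)/((1-s)³(1+s))` (field `x` of the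
lmKdV₂ system). -/
theorem lmKdV_lt_lmKdV2
    (a b c : ℕ → ℝ)
    (ha : (((1 - Polynomial.X) ^ 3 : Polynomial ℝ) : PowerSeries ℝ) *
        PowerSeries.mk a =
      ((Polynomial.X ^ 2 - Polynomial.X + 1 : Polynomial ℝ) : PowerSeries ℝ))
    (hb : (((1 - Polynomial.X) ^ 3 * (1 + Polynomial.X) : Polynomial ℝ) :
        PowerSeries ℝ) * PowerSeries.mk b =
      ((Polynomial.X ^ 3 + 2 * Polynomial.X ^ 2 + 1 : Polynomial ℝ) : PowerSeries ℝ))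
    (hc : (((1 - Polynomial.X) ^ 3 * (1 + Polynomial.X) : Polynomial ℝ) :
        PowerSeries ℝ) * PowerSeries.mk c =
      ((Polynomial.X ^ 3 + 2 * Polynomial.X + 1 : Polynomial ℝ) : PowerSeries ℝ)) :
    ∀ k : ℕ, 2 ≤ k → a k < b k ∧ b k < c k := by
  simp only [Polynomial.coe_mul, Polynomial.coe_pow, Polynomial.coe_sub, Polynomial.coe_add,
    Polynomial.coe_one, Polynomial.coe_X,
    show ((2 : Polynomial ℝ) : PowerSeries ℝ) = 2 from map_ofNat Polynomial.coeToPowerSeries.ringHom 2]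
    at ha hb hc
  set G : PowerSeries ℝ := PowerSeries.mk 1
  set E : PowerSeries ℝ := PowerSeries.mk fun n => if Even n then (1 : ℝ) else 0
  have hG : G * (1 - PowerSeries.X) = 1 := PowerSeries.mk_one_mul_one_sub_eq_one ℝ
  have hE : (1 - PowerSeries.X ^ 2) * E = 1 := one_sub_X_sq_mul_mk_even
  have hD : (1 - PowerSeries.X) ^ 3 * (1 + PowerSeries.X) * (G * (G * E)) = 1 := by
    linear_combination (G * (1 - PowerSeries.X) + 1) * (1 - PowerSeries.X ^ 2) * E * hG + hE
  have hGE : ∀ n, 0 < PowerSeries.coeff n (G * E) := by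
    refine coeff_mul_pos_of_pos (fun n => by simp [G]) (fun n => ?_) (by simp [E])
    rw [PowerSeries.coeff_mk]
    positivity
  have hGGE : ∀ n, 0 < PowerSeries.coeff n (G * (G * E)) :=
    coeff_mul_pos_of_pos (fun n => by simp [G]) (fun n => (hGE n).le) (hGE 0)
  have hba : PowerSeries.mk b - PowerSeries.mk a =
      PowerSeries.X ^ 2 * (G * (G * E) + G * (G * E)) := by
    linear_combination (PowerSeries.mk a - PowerSeries.mk b) * hD +
      G * (G * E) * hb - G * (G * E) * (1 + PowerSeries.X) * ha
  have hcb : PowerSeries.mk c - PowerSeries.mk b = PowerSeries.X * (G * E + G * E) := by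
    linear_combination (PowerSeries.mk b - PowerSeries.mk c) * hD +
      G * (G * E) * hc - G * (G * E) * hb + 2 * PowerSeries.X * G * E * hG
  intro k hk
  obtain ⟨n, rfl⟩ := Nat.exists_eq_add_of_le' hk
  have hba' := congrArg (PowerSeries.coeff (n + 2)) hba
  have hcb' := congrArg (PowerSeries.coeff (n + 1 + 1)) hcb
  rw [PowerSeries.coeff_X_pow_mul, map_sub, map_add, PowerSeries.coeff_mk,
    PowerSeries.coeff_mk] at hba'
  rw [PowerSeries.coeff_succ_X_mul, map_sub, map_add, PowerSeries.coeff_mk,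
    PowerSeries.coeff_mk] at hcb'
  exact ⟨by linarith [hGGE n], by linarith [hGE (n + 1)]⟩
end

section
/- For each of the three polynomials P_x(s) = 4s⁶ + 3s⁵ + 5s⁴ + s³ + 2s² + s + 1, P_y(s) = 2s⁷ + 2s⁶ + 3s⁵ + 3s⁴ + 3s³ + 2s² + s + 1, and P_z(s) = 5s⁶ + 3s⁵ + 3s⁴ + s³ + 2s² + 2s + 1, let (d_k)_{k∈ℕ} be the Taylor coefficients at 0 of the rational function P_i(s)/((1 − s)³(s² + s + 1)²). Then in each case d_k/k² → 17/18 as k → ∞; in particular all three sequences have quadratic growth and vanishing algebraic entropy lim_{k→∞} (1/k)·log d_k = 0. -/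
open Filter Polynomial

lemma abs_le_sum_range_of_one_sub_X_pow_mul_mk {m : ℕ} (hm : 0 < m) {g h : ℕ → ℝ}
    (hgh : (1 - PowerSeries.X ^ m : PowerSeries ℝ) * PowerSeries.mk g = PowerSeries.mk h)
    (k : ℕ) : |g k| ≤ ∑ j ∈ Finset.range (k + 1), |h j| := by
  induction k using Nat.strong_induction_on with
  | _ k ih =>
    have hk := congrArg (PowerSeries.coeff k) hgh
    rw [sub_mul, one_mul, map_sub, PowerSeries.coeff_X_pow_mul'] at hk
    simp only [PowerSeries.coeff_mk] at hk
    rw [Finset.sum_range_succ]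
    split_ifs at hk with hmk
    · have hsum : ∑ j ∈ Finset.range (k - m + 1), |h j| ≤ ∑ j ∈ Finset.range k, |h j| :=
        Finset.sum_le_sum_of_subset_of_nonneg
          (Finset.range_subset_range.2 (by omega)) fun _ _ _ => abs_nonneg _
      have hg : g k = g (k - m) + h k := by linarith
      rw [hg]
      exact (abs_add_le _ _).trans (by linarith [ih (k - m) (by omega)])
    · have hg : g k = h k := by linarith
      rw [hg]
      linarith [Finset.sum_nonneg fun j (_ : j ∈ Finset.range k) => abs_nonneg (h j)]

lemma sum_range_abs_coeff_le (R : ℝ[X]) (k : ℕ) :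
    ∑ j ∈ Finset.range k, |R.coeff j| ≤ ∑ j ∈ R.support, |R.coeff j| := by
  rw [← Finset.sum_filter_ne_zero (s := Finset.range k)]
  refine Finset.sum_le_sum_of_subset_of_nonneg (fun j hj => ?_) fun _ _ _ => abs_nonneg _
  simpa using (Finset.mem_filter.1 hj).2

/-- Division of a polynomial by `(1 - X ^ m) ^ 2` produces coefficients of at most linear growth. -/
lemma exists_abs_le_mul_of_one_sub_X_pow_sq_mul_mk {m : ℕ} (hm : 0 < m) {f : ℕ → ℝ} {R : ℝ[X]}
    (hf : (1 - PowerSeries.X ^ m : PowerSeries ℝ) ^ 2 * PowerSeries.mk f = (R : PowerSeries ℝ)) :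
    ∃ C : ℝ, ∀ k : ℕ, |f k| ≤ C * (k + 1) := by
  obtain ⟨g, hg⟩ : ∃ g : ℕ → ℝ,
      (1 - PowerSeries.X ^ m : PowerSeries ℝ) * PowerSeries.mk f = PowerSeries.mk g :=
    ⟨fun n => PowerSeries.coeff n ((1 - PowerSeries.X ^ m : PowerSeries ℝ) * PowerSeries.mk f),
      by ext n; simp only [PowerSeries.coeff_mk]⟩
  have hR : (1 - PowerSeries.X ^ m : PowerSeries ℝ) * PowerSeries.mk g
      = PowerSeries.mk fun n => R.coeff n := by
    rw [← hg, ← mul_assoc, ← sq, hf]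
    ext n
    simp
  refine ⟨∑ j ∈ R.support, |R.coeff j|, fun k => ?_⟩
  calc |f k| ≤ ∑ j ∈ Finset.range (k + 1), |g j| :=
        abs_le_sum_range_of_one_sub_X_pow_mul_mk hm hg k
    _ ≤ ∑ _j ∈ Finset.range (k + 1), ∑ j ∈ R.support, |R.coeff j| :=
        Finset.sum_le_sum fun j _ =>
          (abs_le_sum_range_of_one_sub_X_pow_mul_mk hm hR j).trans (sum_range_abs_coeff_le R _)
    _ = _ := by simp; ring

lemma exists_abs_sub_le_of_mul_mk_eq {P : ℝ[X]} {d : ℕ → ℝ}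
    (h : (((1 - X) ^ 3 * (X ^ 2 + X + 1) ^ 2 : ℝ[X]) : PowerSeries ℝ) * PowerSeries.mk d =
      (P : PowerSeries ℝ)) :
    ∃ C : ℝ, ∀ k : ℕ, |d k - P.eval 1 / 9 * ((2 + k).choose 2 : ℕ)| ≤ C * (k + 1) := by
  obtain ⟨R, hR⟩ : (X - C 1 : ℝ[X]) ∣ P - C (P.eval 1 / 9) * (X ^ 2 + X + 1) ^ 2 := by
    rw [dvd_iff_isRoot, IsRoot.def]
    simp
    ring
  have hchoose := PowerSeries.mk_add_choose_mul_one_sub_pow_eq_one ℝ 2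
  apply exists_abs_le_mul_of_one_sub_X_pow_sq_mul_mk (m := 3) (R := -R) (by norm_num)
  have hsub : PowerSeries.mk (fun k => d k - P.eval 1 / 9 * ((2 + k).choose 2 : ℕ)) =
      PowerSeries.mk d - PowerSeries.C (P.eval 1 / 9) *
        PowerSeries.mk fun k => ((2 + k).choose 2 : ℝ) := by
    ext n
    simp
  have hR' := congrArg (fun p : ℝ[X] => (p : PowerSeries ℝ)) hR
  simp only [Polynomial.coe_mul, Polynomial.coe_sub, Polynomial.coe_add, Polynomial.coe_pow,
    Polynomial.coe_X, Polynomial.coe_one, Polynomial.coe_C, map_one] at hR' h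
  have hne : (1 - PowerSeries.X : PowerSeries ℝ) ≠ 0 := fun h0 => by
    simpa using congrArg PowerSeries.constantCoeff h0
  apply mul_left_cancel₀ hne
  rw [hsub, Polynomial.coe_neg]
  linear_combination h + hR' -
    PowerSeries.C (P.eval 1 / 9) * (PowerSeries.X ^ 2 + PowerSeries.X + 1) ^ 2 * hchoose

lemma tendsto_div_sq_of_mul_mk_eq {P : ℝ[X]} {d : ℕ → ℝ}
    (h : (((1 - X) ^ 3 * (X ^ 2 + X + 1) ^ 2 : ℝ[X]) : PowerSeries ℝ) * PowerSeries.mk d =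
      (P : PowerSeries ℝ)) :
    Tendsto (fun k : ℕ => d k / (k : ℝ) ^ 2) atTop (nhds (P.eval 1 / 18)) := by
  obtain ⟨C, hC⟩ := exists_abs_sub_le_of_mul_mk_eq h
  have hinv : Tendsto (fun k : ℕ => (k : ℝ)⁻¹) atTop (nhds 0) :=
    tendsto_inv_atTop_nhds_zero_nat
  have herr : Tendsto (fun k : ℕ => (d k - P.eval 1 / 9 * ((2 + k).choose 2 : ℕ)) / (k : ℝ) ^ 2)
      atTop (nhds 0) := by
    refine squeeze_zero_norm' (a := fun k : ℕ => C * ((k : ℝ)⁻¹ * (1 + (k : ℝ)⁻¹))) ?_ ?_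
    · filter_upwards [eventually_gt_atTop 0] with k hk
      have hk' : (0 : ℝ) < k := by exact_mod_cast hk
      rw [Real.norm_eq_abs, abs_div, abs_of_pos (pow_pos hk' 2), div_le_iff₀ (pow_pos hk' 2)]
      refine (hC k).trans_eq ?_
      field_simp
    · simpa using (hinv.mul (hinv.const_add 1)).const_mul C
  have hmain : Tendsto (fun k : ℕ => P.eval 1 / 18 * ((1 + (k : ℝ)⁻¹) * (1 + 2 * (k : ℝ)⁻¹)))
      atTop (nhds (P.eval 1 / 18)) := by
    simpa using ((hinv.const_add 1).mul ((hinv.const_mul 2).const_add 1)).const_mul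
      (P.eval 1 / 18)
  have hsum := herr.add hmain
  rw [zero_add] at hsum
  refine hsum.congr' ?_
  filter_upwards [eventually_gt_atTop 0] with k hk
  have hk' : (k : ℝ) ≠ 0 := by exact_mod_cast hk.ne'
  rw [Nat.cast_choose_two]
  push_cast
  field_simp
  ring

lemma tendsto_log_div_of_tendsto_div_pow {d : ℕ → ℝ} {c : ℝ} (n : ℕ) (hc : c ≠ 0)
    (h : Tendsto (fun k : ℕ => d k / (k : ℝ) ^ n) atTop (nhds c)) :
    Tendsto (fun k : ℕ => Real.log (d k) / (k : ℝ)) atTop (nhds 0) := by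
  have hinv : Tendsto (fun k : ℕ => (k : ℝ)⁻¹) atTop (nhds 0) :=
    tendsto_inv_atTop_nhds_zero_nat
  have hlog : Tendsto (fun k : ℕ => Real.log k / (k : ℝ)) atTop (nhds 0) :=
    Real.isLittleO_log_id_atTop.tendsto_div_nhds_zero.comp tendsto_natCast_atTop_atTop
  have hsum := ((h.log hc).mul hinv).add (hlog.const_mul (n : ℝ))
  simp only [mul_zero, add_zero] at hsum
  refine hsum.congr' ?_
  filter_upwards [eventually_gt_atTop 0, h.eventually_ne hc] with k hk hdk
  have hk' : (k : ℝ) ≠ 0 := by exact_mod_cast hk.ne'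
  have hd : d k ≠ 0 := fun h0 => hdk (by simp [h0])
  rw [Real.log_div hd (pow_ne_zero n hk'), Real.log_pow]
  ring

lemma quadratic_growth_of_mul_mk_eq {P : ℝ[X]} {d : ℕ → ℝ} (hP : P.eval 1 = 17)
    (h : (((1 - X) ^ 3 * (X ^ 2 + X + 1) ^ 2 : ℝ[X]) : PowerSeries ℝ) * PowerSeries.mk d =
      (P : PowerSeries ℝ)) :
    Tendsto (fun k : ℕ => d k / (k : ℝ) ^ 2) atTop (nhds (17 / 18)) ∧
      Tendsto (fun k : ℕ => Real.log (d k) / (k : ℝ)) atTop (nhds 0) := by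
  have hlim := tendsto_div_sq_of_mul_mk_eq h
  rw [hP] at hlim
  exact ⟨hlim, tendsto_log_div_of_tendsto_div_pow 2 (by norm_num) hlim⟩

/-- The Taylor coefficients of `P_i(s)/((1-s)³(s²+s+1)²)` for the three numerators
`P_x, P_y, P_z` of the Boussinesq system all satisfy `d_k/k² → 17/18`: quadratic
growth and vanishing algebraic entropy `lim (1/k) log d_k = 0`. -/
theorem Boussinesq_quadratic_growth
    (dx dy dz : ℕ → ℝ)
    (hx : (((1 - X) ^ 3 * (X ^ 2 + X + 1) ^ 2 : Polynomial ℝ) : PowerSeries ℝ) *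
        PowerSeries.mk dx =
      ((4 * X ^ 6 + 3 * X ^ 5 + 5 * X ^ 4 + X ^ 3 + 2 * X ^ 2 + X + 1 :
        Polynomial ℝ) : PowerSeries ℝ))
    (hy : (((1 - X) ^ 3 * (X ^ 2 + X + 1) ^ 2 : Polynomial ℝ) : PowerSeries ℝ) *
        PowerSeries.mk dy =
      ((2 * X ^ 7 + 2 * X ^ 6 + 3 * X ^ 5 + 3 * X ^ 4 + 3 * X ^ 3 + 2 * X ^ 2 +
        X + 1 : Polynomial ℝ) : PowerSeries ℝ))
    (hz : (((1 - X) ^ 3 * (X ^ 2 + X + 1) ^ 2 : Polynomial ℝ) : PowerSeries ℝ) *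
        PowerSeries.mk dz =
      ((5 * X ^ 6 + 3 * X ^ 5 + 3 * X ^ 4 + X ^ 3 + 2 * X ^ 2 + 2 * X + 1 :
        Polynomial ℝ) : PowerSeries ℝ)) :
    (Tendsto (fun k : ℕ => dx k / (k : ℝ) ^ 2) atTop (nhds (17 / 18)) ∧
      Tendsto (fun k : ℕ => Real.log (dx k) / (k : ℝ)) atTop (nhds 0)) ∧
    (Tendsto (fun k : ℕ => dy k / (k : ℝ) ^ 2) atTop (nhds (17 / 18)) ∧
      Tendsto (fun k : ℕ => Real.log (dy k) / (k : ℝ)) atTop (nhds 0)) ∧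
    (Tendsto (fun k : ℕ => dz k / (k : ℝ) ^ 2) atTop (nhds (17 / 18)) ∧
      Tendsto (fun k : ℕ => Real.log (dz k) / (k : ℝ)) atTop (nhds 0)) := by
  exact ⟨quadratic_growth_of_mul_mk_eq (by norm_num) hx,
    quadratic_growth_of_mul_mk_eq (by norm_num) hy,
    quadratic_growth_of_mul_mk_eq (by norm_num) hz⟩
end
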